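/- Let p and q be distinct odd primes with p ≡ 1 (mod 4) and q ≡ 1 (mod 4), and suppose the Legendre symbol (p/q) = +1. Then the polynomial h(x) = (x² − p)(x² − q)(x² − pq) has a root modulo every positive integer. -/

import Mathlib

theorem exists_prime_pow_dvd_sq_sub {l a : ℤ} (hl : Prime l) (h2 : ¬ l ∣ 2) (ha : ¬ l ∣ a)
    (h : ∃ x, l ∣ x ^ 2 - a) (k : ℕ) : ∃ x, l ^ (k + 1) ∣ x ^ 2 - a := by
  induction k with
  | zero => simpa using h
  | succ k ih =>
    obtain ⟨x, c, hc⟩ := ih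
    have hx : ¬ l ∣ 2 * x := by
      rw [hl.dvd_mul]
      rintro (h | h)
      · exact h2 h
      · refine ha ?_
        have h3 : a = x * x - l * (l ^ k * c) := by linear_combination (-1 : ℤ) * hc
        rw [h3]
        exact dvd_sub (h.mul_left x) (dvd_mul_right _ _)
    obtain ⟨u, v, huv⟩ := (hl.irreducible.coprime_iff_not_dvd.2 hx).symm
    refine ⟨x - l ^ (k + 1) * (c * u), c * v + l ^ k * (c * u) ^ 2, ?_⟩
    linear_combination hc - l ^ (k + 1) * c * huv

theorem exists_two_pow_dvd_sq_sub {a : ℤ} (ha : a % 8 = 1) (k : ℕ) :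
    ∃ x : ℤ, 2 ^ (k + 3) ∣ x ^ 2 - a := by
  suffices ∃ y : ℤ, 2 ^ (k + 3) ∣ (2 * y + 1) ^ 2 - a from
    let ⟨y, hy⟩ := this; ⟨2 * y + 1, hy⟩
  induction k with
  | zero => exact ⟨0, by norm_num; omega⟩
  | succ k ih =>
    obtain ⟨y, c, hc⟩ := ih
    refine ⟨y + 2 ^ (k + 1) * c, c * (y + 1) + 2 ^ k * c ^ 2, ?_⟩
    linear_combination hc

theorem Polynomial.exists_dvd_eval_of_forall_prime_pow (f : Polynomial ℤ)
    (h : ∀ l k : ℕ, l.Prime → ∃ x : ℤ, (l : ℤ) ^ k ∣ f.eval x) (m : ℕ) (hm : 0 < m) :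
    ∃ x : ℤ, (m : ℤ) ∣ f.eval x := by
  induction m using Nat.recOnPosPrimePosCoprime with
  | prime_pow l k hl _ => simpa using h l k hl
  | zero => exact absurd hm (lt_irrefl 0)
  | one => exact ⟨0, by simp⟩
  | coprime a b ha hb hab iha ihb =>
    obtain ⟨x, hx⟩ := iha (by omega)
    obtain ⟨y, hy⟩ := ihb (by omega)
    have hc : IsCoprime (a : ℤ) b := Nat.isCoprime_iff_coprime.2 hab
    obtain ⟨u, v, huv⟩ := id hc
    refine ⟨x + (y - x) * (u * a), ?_⟩
    push_cast
    refine hc.mul_dvd ?_ ?_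
    · refine (dvd_sub_left hx).1 (dvd_trans ?_ (f.sub_dvd_eval_sub _ x))
      exact ⟨(y - x) * u, by ring⟩
    · refine (dvd_sub_left hy).1 (dvd_trans ?_ (f.sub_dvd_eval_sub _ y))
      exact ⟨(x - y) * v, by linear_combination (y - x) * huv⟩

theorem exists_prime_pow_dvd_sq_sub_of_isSquare {l : ℕ} (hl : l.Prime) (h2 : l ≠ 2) {a : ℤ}
    (ha : (a : ZMod l) ≠ 0) (h : IsSquare (a : ZMod l)) (k : ℕ) :
    ∃ x : ℤ, (l : ℤ) ^ k ∣ x ^ 2 - a := by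
  obtain ⟨y, hy⟩ := h
  obtain ⟨x, rfl⟩ := ZMod.intCast_surjective y
  obtain ⟨z, hz⟩ := exists_prime_pow_dvd_sq_sub (Nat.prime_iff_prime_int.1 hl)
    (fun h => h2 ((Nat.prime_dvd_prime_iff_eq hl Nat.prime_two).1 (by exact_mod_cast h)))
    (fun h => ha ((ZMod.intCast_zmod_eq_zero_iff_dvd a l).2 h))
    ⟨x, (ZMod.intCast_zmod_eq_zero_iff_dvd _ l).1 (by push_cast; rw [hy]; ring)⟩ k
  exact ⟨z, (pow_dvd_pow _ k.le_succ).trans hz⟩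

/-- Let `p` and `q` be distinct primes with `p ≡ q ≡ 1 (mod 4)` and `(p/q) = +1`.
Then `h(x) = (x² - p)(x² - q)(x² - pq)` has a root modulo every positive integer. -/
theorem stmt_9 (p q : ℕ) (hp : p.Prime) (hq : q.Prime) (hpodd : p ≠ 2)
    (hqodd : q ≠ 2) (hpq : p ≠ q) (hp4 : p % 4 = 1) (hq4 : q % 4 = 1)
    (hleg : @legendreSym q ⟨hq⟩ (p : ℤ) = 1) :
    ∀ m : ℕ, 0 < m → ∃ x : ℤ,
      (m : ℤ) ∣ (x ^ 2 - (p : ℤ)) * (x ^ 2 - (q : ℤ)) * (x ^ 2 - (p : ℤ) * q) := by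
  intro m hm
  open Polynomial in
  have key := Polynomial.exists_dvd_eval_of_forall_prime_pow
    ((X ^ 2 - C (p : ℤ)) * (X ^ 2 - C (q : ℤ)) * (X ^ 2 - C ((p : ℤ) * q)))
  simp only [Polynomial.eval_mul, Polynomial.eval_sub, Polynomial.eval_pow, Polynomial.eval_X,
    Polynomial.eval_C] at key
  refine key (fun l k hl => ?_) m hm
  suffices (∃ x : ℤ, (l : ℤ) ^ k ∣ x ^ 2 - p) ∨ (∃ x : ℤ, (l : ℤ) ^ k ∣ x ^ 2 - q) ∨
      ∃ x : ℤ, (l : ℤ) ^ k ∣ x ^ 2 - (p : ℤ) * q by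
    rcases this with ⟨x, h⟩ | ⟨x, h⟩ | ⟨x, h⟩
    · exact ⟨x, (h.mul_right _).mul_right _⟩
    · exact ⟨x, (h.mul_left _).mul_right _⟩
    · exact ⟨x, h.mul_left _⟩
  have := Fact.mk hp
  have := Fact.mk hq
  have := Fact.mk hl
  by_cases hl2 : l = 2
  · subst hl2
    have two {a : ℤ} (ha : a % 8 = 1) : ∃ x : ℤ, ((2 : ℕ) : ℤ) ^ k ∣ x ^ 2 - a :=
      let ⟨x, hx⟩ := exists_two_pow_dvd_sq_sub ha k
      ⟨x, (pow_dvd_pow _ (by omega)).trans hx⟩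
    by_cases h1 : (p : ℤ) % 8 = 1
    · exact .inl (two h1)
    by_cases h2 : (q : ℤ) % 8 = 1
    · exact .inr (.inl (two h2))
    refine .inr (.inr (two ?_))
    have h3 : (p : ℤ) % 8 = 5 := by omega
    have h4 : (q : ℤ) % 8 = 5 := by omega
    simp [Int.mul_emod, h3, h4]
  have ne_zero {r : ℕ} (hr : r.Prime) (hlr : l ≠ r) : ((r : ℤ) : ZMod l) ≠ 0 := by
    rw [Int.cast_natCast, Ne, ZMod.natCast_eq_zero_iff]
    exact fun h => hlr ((Nat.prime_dvd_prime_iff_eq hl hr).1 h)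
  by_cases hlq : l = q
  · subst hlq
    have h0 := ne_zero hp hpq.symm
    exact .inl (exists_prime_pow_dvd_sq_sub_of_isSquare hl hl2 h0
      ((legendreSym.eq_one_iff l h0).1 hleg) k)
  by_cases hlp : l = p
  · subst hlp
    have h0 := ne_zero hq hpq
    rw [← legendreSym.quadratic_reciprocity_one_mod_four hq4 hl2] at hleg
    exact .inr (.inl (exists_prime_pow_dvd_sq_sub_of_isSquare hl hl2 h0
      ((legendreSym.eq_one_iff l h0).1 hleg) k))
  have hp0 := ne_zero hp hlp
  have hq0 := ne_zero hq hlq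
  have lift {a : ℤ} (h0 : (a : ZMod l) ≠ 0) (h : legendreSym l a = 1) :
      ∃ x : ℤ, (l : ℤ) ^ k ∣ x ^ 2 - a :=
    exists_prime_pow_dvd_sq_sub_of_isSquare hl hl2 h0 ((legendreSym.eq_one_iff l h0).1 h) k
  rcases legendreSym.eq_one_or_neg_one l hp0 with h1 | h1
  · exact .inl (lift hp0 h1)
  rcases legendreSym.eq_one_or_neg_one l hq0 with h2 | h2
  · exact .inr (.inl (lift hq0 h2))
  exact .inr (.inr (lift (by push_cast at hp0 hq0 ⊢; exact mul_ne_zero hp0 hq0)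
    (by rw [legendreSym.mul, h1, h2]; norm_num)))
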